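/- Let M = {1^{k_1}, 2^{k_2}, ..., n^{k_n}} be a nonempty multiset with each k_i ≥ 1. There exists a bijection from ℐ𝒯_M, the set of weakly increasing trees in 𝒯_M, onto the set of Stirling permutations of M such that for every T ∈ ℐ𝒯_M, cdes(T) = des(φ(T)), casc(T) = asc(φ(T)), and eleaf(T) = plat(φ(T)). -/

import Mathlib

/-! Common definitions: words (permutations of multisets), their statistics,
ordered labeled trees and their cyclic statistics. -/

attribute [local instance] Classical.propDecidable

/-- `asc`: number of indices `0 ≤ i ≤ m` with `π_i < π_{i+1}`, convention `π_0 = π_{m+1} = 0`. -/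
def ascW (w : List ℕ) : ℕ :=
  (((0 :: (w ++ [0])).zip (w ++ [0])).countP fun p => decide (p.1 < p.2))

def desW (w : List ℕ) : ℕ :=
  (((0 :: (w ++ [0])).zip (w ++ [0])).countP fun p => decide (p.2 < p.1))

def platW (w : List ℕ) : ℕ :=
  (((0 :: (w ++ [0])).zip (w ++ [0])).countP fun p => decide (p.1 = p.2))

/-- quasi-Stirling: no indices `i < j < k < l` with `π_i = π_k` and `π_j = π_l`. -/
def IsQuasiStirling (w : List ℕ) : Prop :=
  ¬ ∃ l, l < w.length ∧ ∃ k, k < l ∧ ∃ j, j < k ∧ ∃ i, i < j ∧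
      w.getD i 0 = w.getD k 0 ∧ w.getD j 0 = w.getD l 0

/-- Stirling: no indices `i < j < k` with `π_i = π_k` and `π_j < π_i`. -/
def IsStirling (w : List ℕ) : Prop :=
  ¬ ∃ k, k < w.length ∧ ∃ j, j < k ∧ ∃ i, i < j ∧
      w.getD i 0 = w.getD k 0 ∧ w.getD j 0 < w.getD i 0

/-- The multiset `{1^{k 1}, 2^{k 2}, …, n^{k n}}`. -/
def msetM (n : ℕ) (k : ℕ → ℕ) : Multiset ℕ :=
  ∑ i ∈ Finset.Icc 1 n, Multiset.replicate (k i) i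

/-- The finite set of all words whose multiset of letters is `M`. -/
noncomputable def permsOf (M : Multiset ℕ) : Finset (List ℕ) :=
  M.toList.permutations.toFinset

/-- The finite set of quasi-Stirling permutations of `M`. -/
noncomputable def qsPerms (M : Multiset ℕ) : Finset (List ℕ) :=
  (permsOf M).filter IsQuasiStirling

/-- The finite set of Stirling permutations of `M`. -/
noncomputable def sPerms (M : Multiset ℕ) : Finset (List ℕ) :=
  (permsOf M).filter IsStirling

open MvPolynomial in
/-- `Q̄_M(x,y,z)`, with `x = X 0`, `y = X 1`, `z = X 2`. -/
noncomputable def QbarPoly (M : Multiset ℕ) : MvPolynomial (Fin 3) ℤ :=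
  ∑ w ∈ qsPerms M, X 0 ^ ascW w * X 1 ^ desW w * X 2 ^ platW w

open MvPolynomial in
/-- `Q_M(x,y,z)`, with `x = X 0`, `y = X 1`, `z = X 2`. -/
noncomputable def QPoly (M : Multiset ℕ) : MvPolynomial (Fin 3) ℤ :=
  ∑ w ∈ sPerms M, X 0 ^ ascW w * X 1 ^ desW w * X 2 ^ platW w

/-! Cyclic statistics of a word `w_0 w_1 … w_ℓ` read cyclically. -/

/-- Number of cyclic descents of a word: indices `i` with `w_i > w_{i+1}`, indices mod `ℓ+1`. -/
def cdesW (w : List ℕ) : ℕ := ((w.zip (w.rotate 1)).countP fun p => decide (p.2 < p.1))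

/-- Number of cyclic ascents. -/
def cascW (w : List ℕ) : ℕ := ((w.zip (w.rotate 1)).countP fun p => decide (p.1 < p.2))

/-- The list of cyclic triples `(w_{i-1}, w_i, w_{i+1})`, indices mod `ℓ+1`. -/
def cycTriples (w : List ℕ) : List (ℕ × ℕ × ℕ) :=
  (w.rotate (w.length - 1)).zip (w.zip (w.rotate 1))

/-- Number of double cyclic descents of a word: indices with `w_{i-1} > w_i > w_{i+1}`. -/
def dcdesW (w : List ℕ) : ℕ :=
  ((cycTriples w).countP fun p => decide (p.2.1 < p.1 ∧ p.2.2 < p.2.1))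

/-- Number of double cyclic ascents of a word: indices with `w_{i-1} < w_i < w_{i+1}`. -/
def dcascW (w : List ℕ) : ℕ :=
  ((cycTriples w).countP fun p => decide (p.1 < p.2.1 ∧ p.2.1 < p.2.2))

/-- Number of cyclic peaks of a word: indices with `w_{i-1} < w_i > w_{i+1}`. -/
def cpeakW (w : List ℕ) : ℕ :=
  ((cycTriples w).countP fun p => decide (p.1 < p.2.1 ∧ p.2.2 < p.2.1))

/-- Number of cyclic valleys of a word: indices with `w_{i-1} > w_i < w_{i+1}`. -/
def cvalW (w : List ℕ) : ℕ :=
  ((cycTriples w).countP fun p => decide (p.2.1 < p.1 ∧ p.2.1 < p.2.2))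

/-- Ordered labeled trees: rooted plane trees with labels in `ℕ`. -/
inductive LTree : Type where
  | node (label : ℕ) (children : List LTree) : LTree

namespace LTree

/-- The label of the root. -/
def label : LTree → ℕ
  | node a _ => a

theorem sizeOf_lt_of_mem {s : LTree} {ts : List LTree} (h : s ∈ ts) {a : ℕ} :
    sizeOf s < sizeOf (LTree.node a ts) := by
  have := List.sizeOf_lt_of_mem h
  simp only [node.sizeOf_spec]
  omega

/-- The multiset of all vertex labels. -/
def labels : LTree → Multiset ℕ
  | node a ts => a ::ₘ (ts.attach.map (fun s => labels s.1)).sum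
decreasing_by exact sizeOf_lt_of_mem s.2

/-- The word `v_0 v_1 … v_ℓ` associated to a vertex: its label followed by the labels of
its children from left to right. -/
def wordOf : LTree → List ℕ
  | node a ts => a :: ts.map label

/-- `cdes(T) = ∑_{u ∈ V(T)} cdes(u)`. -/
def cdes : LTree → ℕ
  | node a ts => cdesW (a :: ts.map label) + (ts.attach.map (fun s => cdes s.1)).sum
decreasing_by exact sizeOf_lt_of_mem s.2

/-- `casc(T) = ∑_{u ∈ V(T)} casc(u)`. -/
def casc : LTree → ℕ
  | node a ts => cascW (a :: ts.map label) + (ts.attach.map (fun s => casc s.1)).sum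
decreasing_by exact sizeOf_lt_of_mem s.2

/-- Auxiliary: number of leaves at even level, `b = true` meaning the current root is at
even level. -/
def eleafAux : LTree → Bool → ℕ
  | node _ ts, b => (cond b (if ts.isEmpty then 1 else 0) 0)
      + (ts.attach.map (fun s => eleafAux s.1 !b)).sum
decreasing_by exact sizeOf_lt_of_mem s.2

/-- `eleaf(T)`: the number of leaves of `T` at even level. -/
def eleaf (T : LTree) : ℕ := eleafAux T true

/-- Auxiliary: given a word-statistic `f`, sum `f (wordOf u)` over all vertices `u` at even
level (`b = true` meaning the current root is at even level).  Since every vertex of a tree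
is classified (as a double cyclic descent/ascent, cyclic peak/valley) by exactly one index
of the word of an even vertex — an even vertex by index `0` of its own word, an odd vertex
by its position in the word of its (even) parent — the corresponding tree statistics are
obtained by summing the word statistics over the even vertices. -/
def evenSum (f : List ℕ → ℕ) : LTree → Bool → ℕ
  | node a ts, b => (cond b (f (a :: ts.map label)) 0)
      + (ts.attach.map (fun s => evenSum f s.1 !b)).sum
decreasing_by exact sizeOf_lt_of_mem s.2

/-- `dcdes(T)`: the number of vertices of `T` that are double cyclic descents. -/
def dcdes (T : LTree) : ℕ := evenSum dcdesW T true

/-- `dcasc(T)`: the number of vertices of `T` that are double cyclic ascents. -/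
def dcasc (T : LTree) : ℕ := evenSum dcascW T true

/-- `cpeak(T)`: the number of vertices of `T` that are cyclic peaks. -/
def cpeak (T : LTree) : ℕ := evenSum cpeakW T true

/-- `cval(T)`: the number of vertices of `T` that are cyclic valleys. -/
def cval (T : LTree) : ℕ := evenSum cvalW T true

/-- Auxiliary: every odd vertex labeled `i` has exactly `k i - 1` children, all labeled `i`
(`b = true` meaning the current root is at even level). -/
def oddOK (k : ℕ → ℕ) : LTree → Bool → Prop
  | node a ts, b => (b = false → (ts.length = k a - 1 ∧ ∀ s ∈ ts, s.label = a)) ∧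
      ∀ s : {x // x ∈ ts}, oddOK k s.1 (!b)
decreasing_by exact sizeOf_lt_of_mem s.2

/-- Weakly increasing: the labels along the path from the root to any leaf are weakly
increasing from top to bottom, i.e. every child's label is at least its parent's label. -/
def incr : LTree → Prop
  | node a ts => (∀ s ∈ ts, a ≤ s.label) ∧ ∀ s : {x // x ∈ ts}, incr s.1
decreasing_by exact sizeOf_lt_of_mem s.2

end LTree

/-- Membership in `𝒯_M` for `M = {1^{k 1}, …, n^{k n}}`: the multiset of vertex labels is
`{0} ∪ M`, the root is labeled `0`, and every odd vertex labeled `i` has exactly `k i - 1`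
children, all labeled `i`. -/
def memTM (n : ℕ) (k : ℕ → ℕ) (T : LTree) : Prop :=
  T.label = 0 ∧ T.labels = 0 ::ₘ msetM n k ∧ T.oddOK k true

/-- Membership in `ℐ𝒯_M`: weakly increasing trees in `𝒯_M`. -/
def memIT (n : ℕ) (k : ℕ → ℕ) (T : LTree) : Prop :=
  memTM n k T ∧ T.incr

namespace LTree

theorem induction_on_children {P : LTree → Prop}
    (h : ∀ a ts, (∀ s ∈ ts, P s) → P (node a ts)) : ∀ T, P T
  | node a ts => h a ts fun s _ => induction_on_children h s
decreasing_by exact sizeOf_lt_of_mem ‹_›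

theorem label_node (a : ℕ) (ts : List LTree) : (node a ts).label = a := rfl

theorem labels_node (a : ℕ) (ts : List LTree) :
    (node a ts).labels = a ::ₘ (ts.map labels).sum := by
  rw [labels, List.attach_map_val]

theorem cdes_node (a : ℕ) (ts : List LTree) :
    (node a ts).cdes = cdesW (a :: ts.map label) + (ts.map cdes).sum := by
  rw [cdes, List.attach_map_val]

theorem casc_node (a : ℕ) (ts : List LTree) :
    (node a ts).casc = cascW (a :: ts.map label) + (ts.map casc).sum := by
  rw [casc, List.attach_map_val]

theorem eleafAux_node (a : ℕ) (ts : List LTree) (b : Bool) :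
    (node a ts).eleafAux b = (cond b (if ts.isEmpty then 1 else 0) 0)
      + (ts.map fun s => s.eleafAux !b).sum := by
  rw [eleafAux, List.attach_map_val (f := fun s : LTree => s.eleafAux !b)]

theorem oddOK_node {k : ℕ → ℕ} {a : ℕ} {ts : List LTree} {b : Bool} :
    (node a ts).oddOK k b ↔ (b = false → (ts.length = k a - 1 ∧ ∀ s ∈ ts, s.label = a)) ∧
      ∀ s ∈ ts, s.oddOK k (!b) := by
  rw [oddOK, Subtype.forall]

theorem incr_node {a : ℕ} {ts : List LTree} :
    (node a ts).incr ↔ (∀ s ∈ ts, a ≤ s.label) ∧ ∀ s ∈ ts, s.incr := by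
  rw [incr, Subtype.forall]

/-- The word read off a tree by going around it: an odd vertex writes its label before, between
and after the words of its children, while an even vertex writes nothing. The Boolean records
whether the root is at even level. -/
def toWord : LTree → Bool → List ℕ
  | node _ ts, true => (ts.attach.map fun s => toWord s.1 false).flatten
  | node a ts, false => a :: (ts.attach.map fun s => toWord s.1 true ++ [a]).flatten
decreasing_by all_goals exact sizeOf_lt_of_mem s.2

theorem toWord_true (a : ℕ) (ts : List LTree) :
    (node a ts).toWord true = ts.flatMap fun s => s.toWord false := by
  rw [toWord, List.attach_map_val (f := fun s : LTree => s.toWord false), List.flatMap_def]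

theorem toWord_false (a : ℕ) (ts : List LTree) :
    (node a ts).toWord false = a :: ts.flatMap fun s => s.toWord true ++ [a] := by
  rw [toWord, List.attach_map_val (f := fun s : LTree => s.toWord true ++ [a]), List.flatMap_def]

theorem label_mem_toWord_false (T : LTree) : T.label ∈ T.toWord false := by
  obtain ⟨a, ts⟩ := T
  simp [toWord_false, label]

theorem labels_eq_toWord {k : ℕ → ℕ} (T : LTree) :
    (T.oddOK k true → T.labels = T.label ::ₘ (T.toWord true : Multiset ℕ)) ∧
      (T.oddOK k false → T.labels = (T.toWord false : Multiset ℕ)) := by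
  induction T using induction_on_children with
  | h a ts ih =>
    simp only [oddOK_node, labels_node, toWord_true, toWord_false, label_node,
      ← Multiset.cons_coe]
    constructor
    · intro h
      replace h := h.2
      congr 1
      induction ts with
      | nil => simp
      | cons t ts iht =>
        simp only [List.forall_mem_cons] at ih h
        simp [(ih.1.2 h.1), iht ih.2 h.2, ← Multiset.coe_add]
    · intro h
      have h' := (h.1 (by simp)).2
      replace h := h.2
      congr 1
      induction ts with
      | nil => simp
      | cons t ts iht =>
        simp only [List.forall_mem_cons] at ih h h'
        simp [(ih.1.1 h.1), h'.1, iht ih.2 h'.2 h.2, ← Multiset.coe_add, ← Multiset.cons_coe]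

theorem length_le_count_flatMap (a : ℕ) (ts : List LTree) :
    ts.length ≤ (ts.flatMap fun s => s.toWord true ++ [a]).count a := by
  induction ts with
  | nil => simp
  | cons t ts ih => simp; omega

theorem le_count_toWord {k : ℕ → ℕ} (x : ℕ) (T : LTree) :
    ∀ b, T.oddOK k b → x ∈ T.toWord b → k x ≤ (T.toWord b).count x := by
  induction T using induction_on_children with
  | h a ts ih =>
    rintro (_ | _) h hx
    · rw [oddOK_node] at h
      simp only [toWord_false, List.mem_cons, List.mem_flatMap] at hx ⊢
      by_cases hxa : x = a
      · subst hxa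
        have := length_le_count_flatMap x ts
        have := (h.1 rfl).1
        simp only [List.count_cons_self]
        omega
      · obtain hx | ⟨s, hs, hx⟩ := hx
        · exact absurd hx hxa
        · have hx : x ∈ s.toWord true := by simpa [hxa] using hx
          refine (ih s hs true (h.2 s hs) hx).trans (List.Sublist.count_le x ?_)
          refine List.Sublist.cons a (List.Sublist.trans ?_ (List.sublist_flatten_of_mem
            (List.mem_map_of_mem hs)))
          simp
    · rw [oddOK_node] at h
      simp only [toWord_true, List.mem_flatMap] at hx ⊢
      obtain ⟨s, hs, hx⟩ := hx
      exact (ih s hs false (h.2 s hs) hx).trans (List.Sublist.count_le x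
        (List.sublist_flatten_of_mem (List.mem_map_of_mem hs)))

end LTree

theorem append_cons_inj_of_notMem_left {a : ℕ} {u v p q : List ℕ} (hu : a ∉ u) (hv : a ∉ v)
    (h : u ++ a :: p = v ++ a :: q) : u = v ∧ p = q := by
  induction u generalizing v with
  | nil =>
    rcases v with _ | ⟨y, v⟩
    · simpa using h
    · exact absurd (List.cons.inj h).1 (List.ne_of_not_mem_cons hv)
  | cons x u ih =>
    rcases v with _ | ⟨y, v⟩
    · exact absurd (List.cons.inj h).1.symm (List.ne_of_not_mem_cons hu)
    · simp only [List.mem_cons, not_or, List.cons_append, List.cons.injEq] at hu hv h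
      exact ⟨by rw [h.1, (ih hu.2 hv.2 h.2).1], (ih hu.2 hv.2 h.2).2⟩

/-- Words without a subword `x y x` with `y < x`. -/
def NoDip (w : List ℕ) : Prop := ∀ x y, y < x → ¬ [x, y, x].Sublist w

theorem isStirling_iff_noDip (w : List ℕ) : IsStirling w ↔ NoDip w := by
  constructor
  · intro h x y hxy hs
    obtain ⟨is, h1, h2⟩ := List.sublist_eq_map_getElem hs
    rcases is with _ | ⟨a, _ | ⟨b, _ | ⟨c, _ | _⟩⟩⟩ <;> simp at h1 h2
    refine h ⟨c, c.2, b, h2.2, a, h2.1.1, ?_⟩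
    simp [← h1.1, ← h1.2.1, ← h1.2.2, hxy]
  · rintro h ⟨c, hc, b, hb, a, ha, h1, h2⟩
    rw [List.getD_eq_getElem _ _ (by omega), List.getD_eq_getElem _ _ (by omega)] at h1 h2
    refine h _ _ h2 ?_
    have := List.map_getElem_sublist (l := w)
      (is := [⟨a, by omega⟩, ⟨b, by omega⟩, ⟨c, by omega⟩]) (by simp; omega)
    simpa [← h1] using this

theorem NoDip.sublist {v w : List ℕ} (h : NoDip w) (hs : v.Sublist w) : NoDip v :=
  fun x y hxy hv => h x y hxy (hv.trans hs)

theorem NoDip.append {v w : List ℕ} (hv : NoDip v) (hw : NoDip w)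
    (h : ∀ x ∈ v, x ∈ w → ∀ y ∈ v ++ w, x ≤ y) : NoDip (v ++ w) := by
  intro x y hxy hs
  have hy : y ∈ v ++ w := hs.subset (by simp)
  obtain ⟨l₁, l₂, hl, h1, h2⟩ := List.sublist_append_iff.1 hs
  rcases l₁ with _ | ⟨a, l₁⟩
  · simp only [List.nil_append] at hl
    exact hw x y hxy (hl ▸ h2)
  · rcases List.eq_nil_or_concat l₂ with rfl | ⟨l₃, b, rfl⟩
    · simp only [List.append_nil] at hl
      exact hv x y hxy (hl ▸ h1)
    · have ha : a = x := by simp at hl; exact hl.1.symm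
      have hb : b = x := by
        have := congrArg List.getLast? hl
        rw [List.concat_eq_append, ← List.append_assoc, List.getLast?_concat] at this
        simpa using this.symm
      have := h x (ha ▸ h1.subset (by simp)) (hb ▸ h2.subset (by simp)) y hy
      omega

theorem noDip_singleton (i : ℕ) : NoDip [i] := fun x y _ hs => by
  simpa using hs.length_le

theorem noDip_flatten {ws : List (List ℕ)} (h : ∀ w ∈ ws, NoDip w)
    (hd : ws.Pairwise List.Disjoint) : NoDip ws.flatten := by
  induction ws with
  | nil => intro x y _ hs; simp at hs
  | cons w ws ih =>
    rw [List.flatten_cons]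
    rw [List.pairwise_cons] at hd
    refine NoDip.append (h w (by simp)) (ih (fun v hv => h v (by simp [hv])) hd.2) ?_
    intro x hx hx'
    obtain ⟨v, hv, hxv⟩ := List.mem_flatten.1 hx'
    exact absurd hxv (hd.1 v hv hx)

theorem noDip_cons_flatMap {i : ℕ} {ws : List (List ℕ)} (h : ∀ w ∈ ws, NoDip w)
    (hd : ws.Pairwise List.Disjoint) (hi : ∀ w ∈ ws, ∀ x ∈ w, i ≤ x) :
    NoDip (i :: ws.flatMap (· ++ [i])) := by
  induction ws with
  | nil => simpa using noDip_singleton i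
  | cons w ws ih =>
    rw [List.pairwise_cons] at hd
    have hr := ih (fun v hv => h v (by simp [hv])) hd.2 (fun v hv => hi v (by simp [hv]))
    have key : ∀ x, x ∈ i :: ws.flatMap (· ++ [i]) → x = i ∨ ∃ v ∈ ws, x ∈ v := by
      intro x hx
      simp only [List.mem_cons, List.mem_flatMap, List.mem_append, List.not_mem_nil,
        or_false] at hx
      grind
    have hlow : ∀ y ∈ i :: ws.flatMap (· ++ [i]), i ≤ y := by
      intro y hy
      obtain rfl | ⟨v, hv, hyv⟩ := key y hy
      · exact le_rfl
      · exact hi v (by simp [hv]) y hyv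
    have h1 : NoDip (w ++ (i :: ws.flatMap (· ++ [i]))) := by
      refine NoDip.append (h w (by simp)) hr ?_
      intro x hx hx' y hy
      obtain rfl | ⟨v, hv, hxv⟩ := key x hx'
      · obtain hy | hy := List.mem_append.1 hy
        · exact hi w (by simp) y hy
        · exact hlow y hy
      · exact absurd hxv (hd.1 v hv hx)
    have h2 := NoDip.append (noDip_singleton i) h1 (by
      intro x hx _ y hy
      obtain rfl : x = i := by simpa using hx
      simp only [List.mem_append, List.mem_singleton] at hy
      obtain rfl | hy | hy := hy
      · exact le_rfl
      · exact hi w (by simp) y hy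
      · exact hlow y hy)
    simpa using h2

theorem pairwise_disjoint_of_count_le {k : ℕ → ℕ} {ws : List (List ℕ)}
    (h : ∀ w ∈ ws, ∀ x ∈ w, k x ≤ w.count x) (hle : ∀ x, ws.flatten.count x ≤ k x) :
    ws.Pairwise List.Disjoint := by
  induction ws with
  | nil => simp
  | cons w ws ih =>
    simp only [List.flatten_cons, List.count_append] at hle
    refine List.pairwise_cons.2 ⟨fun v hv x hx hxv => ?_,
      ih (fun v hv => h v (by simp [hv])) fun x => (Nat.le_add_left _ _).trans (hle x)⟩
    have h1 := h w (by simp) x hx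
    have h2 : 0 < ws.flatten.count x := List.count_pos_iff.2 (List.mem_flatten.2 ⟨v, hv, hxv⟩)
    have := hle x
    omega

namespace LTree

/-- The conditions, inherited by subtrees, under which `toWord` is injective: odd vertices have
the prescribed children, no letter `x` is written more than `k x` times, and the label of an even
root is not written. -/
structure Good (k : ℕ → ℕ) (T : LTree) (b : Bool) : Prop where
  oddOK : T.oddOK k b
  count_le : ∀ x, (T.toWord b).count x ≤ k x
  label_notMem : b = true → T.label ∉ T.toWord true

theorem Good.child {k : ℕ → ℕ} {a : ℕ} {ts : List LTree} {b : Bool}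
    (h : (node a ts).Good k b) {s : LTree} (hs : s ∈ ts) : s.Good k (!b) := by
  obtain ⟨h1, h2, h3⟩ := h
  have h1' := oddOK_node.1 h1
  refine ⟨h1'.2 s hs, fun x => ?_, fun hb => ?_⟩
  · refine le_trans (List.Sublist.count_le x ?_) (h2 x)
    cases b
    · rw [toWord_false]
      refine List.Sublist.cons a (List.Sublist.trans ?_ (List.sublist_flatten_of_mem
            (List.mem_map_of_mem hs)))
      simp
    · rw [toWord_true]
      exact List.sublist_flatten_of_mem (List.mem_map_of_mem hs)
  · obtain rfl : b = false := by simpa using hb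
    intro hmem
    obtain ⟨hlen, hlab⟩ := h1'.1 rfl
    rw [hlab s hs] at hmem
    have h2 := h2 a
    rw [toWord_false, List.count_cons_self] at h2
    have : ∀ us : List LTree, s ∈ us →
        us.length < (us.flatMap fun s => s.toWord true ++ [a]).count a := by
      intro us hus
      have hcount := List.count_pos_iff.2 hmem
      induction us with
      | nil => simp at hus
      | cons t us ih =>
        have := length_le_count_flatMap a us
        rcases List.mem_cons.1 hus with rfl | hus
        · simp; omega
        · have := ih hus
          simp; omega
    have := this ts hs
    omega

theorem Good.pairwise_disjoint {k : ℕ → ℕ} {a : ℕ} {ts : List LTree} {b : Bool}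
    (h : (node a ts).Good k b) : (ts.map fun s => s.toWord !b).Pairwise List.Disjoint := by
  refine pairwise_disjoint_of_count_le (k := k) ?_ fun x => ?_
  · intro w hw x hx
    obtain ⟨s, hs, rfl⟩ := List.mem_map.1 hw
    exact le_count_toWord x s _ (h.child hs).oddOK hx
  · refine le_trans (List.Sublist.count_le x ?_) (h.count_le x)
    cases b
    · rw [toWord_false]
      refine List.Sublist.cons a ?_
      clear h
      induction ts with
      | nil => simp
      | cons t ts ih =>
        simp only [List.map_cons, List.flatten_cons, List.flatMap_cons]
        exact List.Sublist.append (by simp) ih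
    · rw [toWord_true]
      exact List.Sublist.refl _

theorem Good.nodup {k : ℕ → ℕ} {a : ℕ} {ts : List LTree} (h : (node a ts).Good k true) :
    (a :: ts.map label).Nodup := by
  have hd := List.pairwise_map.1 h.pairwise_disjoint
  refine List.nodup_cons.2 ⟨fun ha => ?_, ?_⟩
  · obtain ⟨s, hs, rfl⟩ := List.mem_map.1 ha
    refine h.label_notMem rfl ?_
    rw [toWord_true]
    exact List.mem_flatMap.2 ⟨s, hs, s.label_mem_toWord_false⟩
  · refine List.pairwise_map.2 (hd.imp fun {s t} hst heq => ?_)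
    exact hst s.label_mem_toWord_false (heq ▸ t.label_mem_toWord_false)

theorem noDip_toWord {k : ℕ → ℕ} (T : LTree) :
    ∀ b, T.Good k b → T.incr → NoDip (T.toWord b) ∧ ∀ x ∈ T.toWord b, T.label ≤ x := by
  induction T using induction_on_children with
  | h a ts ih =>
    intro b h hi
    rw [incr_node] at hi
    have hs : ∀ s ∈ ts, NoDip (s.toWord !b) ∧ ∀ x ∈ s.toWord !b, a ≤ x := fun s hs =>
      ⟨(ih s hs _ (h.child hs) (hi.2 s hs)).1, fun x hx =>
        (hi.1 s hs).trans ((ih s hs _ (h.child hs) (hi.2 s hs)).2 x hx)⟩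
    have hd := h.pairwise_disjoint
    cases b
    · rw [toWord_false]
      constructor
      · have := noDip_cons_flatMap (i := a) (ws := ts.map fun s => s.toWord true)
          (by simpa using fun s hs' => (hs s hs').1) hd (by simpa using fun s hs' => (hs s hs').2)
        simpa [List.flatMap_map] using this
      · intro x hx
        simp only [List.mem_cons, List.mem_flatMap, List.mem_append, List.not_mem_nil,
          or_false] at hx
        obtain rfl | ⟨s, hs', hx | rfl⟩ := hx
        · exact le_rfl
        · exact (hs s hs').2 x hx
        · exact le_rfl
    · rw [toWord_true]
      constructor
      · exact noDip_flatten (by simpa using fun s hs' => (hs s hs').1) hd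
      · intro x hx
        obtain ⟨s, hs', hx⟩ := List.mem_flatMap.1 hx
        exact (hs s hs').2 x hx

theorem toWord_injective {k : ℕ → ℕ} (T : LTree) :
    (∀ S, T.Good k true → S.Good k true → T.label = S.label →
      T.toWord true = S.toWord true → T = S) ∧
    (∀ S l m, T.Good k false → S.Good k false →
      T.toWord false ++ l = S.toWord false ++ m → T = S ∧ l = m) := by
  induction T using induction_on_children with
  | h a ts ih =>
    constructor
    · rintro ⟨c, ss⟩ hT hS hl hw
      obtain rfl : a = c := hl
      rw [toWord_true, toWord_true] at hw
      replace hT := fun s hs => hT.child (s := s) hs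
      replace hS := fun s hs => hS.child (s := s) hs
      congr 1
      induction ts generalizing ss with
      | nil =>
        cases ss with
        | nil => rfl
        | cons s ss =>
          have := s.label_mem_toWord_false
          simp_all
      | cons t ts iht =>
        cases ss with
        | nil =>
          have := t.label_mem_toWord_false
          simp_all
        | cons s ss =>
          simp only [List.flatMap_cons, List.forall_mem_cons] at hw hT hS ih
          obtain ⟨rfl, hw'⟩ := ih.1.2 s _ _ hT.1 hS.1 hw
          rw [iht ih.2 ss hw' hT.2 hS.2]
    · rintro ⟨c, ss⟩ l m hT hS hw
      rw [toWord_false, toWord_false, List.cons_append, List.cons_append, List.cons.injEq] at hw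
      obtain ⟨rfl, hw⟩ := hw
      have hTl := (oddOK_node.1 hT.oddOK).1 rfl
      have hSl := (oddOK_node.1 hS.oddOK).1 rfl
      replace hT := fun s hs => hT.child (s := s) hs
      replace hS := fun s hs => hS.child (s := s) hs
      have hlen : ts.length = ss.length := hTl.1.trans hSl.1.symm
      replace hTl := hTl.2
      replace hSl := hSl.2
      suffices h : ts = ss ∧ l = m by rw [h.1]; exact ⟨rfl, h.2⟩
      induction ts generalizing ss with
      | nil =>
        obtain rfl : ss = [] := by simpa using hlen.symm
        simpa using hw
      | cons t ts iht =>
        cases ss with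
        | nil => simp at hlen
        | cons s ss =>
          simp only [List.flatMap_cons, List.forall_mem_cons, List.append_assoc,
            List.singleton_append, List.length_cons, Nat.add_right_cancel_iff]
            at hw hT hS ih hTl hSl hlen
          have h1 : a ∉ t.toWord true := hTl.1 ▸ hT.1.label_notMem rfl
          have h2 : a ∉ s.toWord true := hSl.1 ▸ hS.1.label_notMem rfl
          have h3 : t.toWord true = s.toWord true ∧
              (ts.flatMap fun s => s.toWord true ++ [a]) ++ l =
                (ss.flatMap fun s => s.toWord true ++ [a]) ++ m := by
            exact append_cons_inj_of_notMem_left h1 h2 hw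
          obtain rfl := ih.1.1 s hT.1 hS.1 (hTl.1.trans hSl.1.symm) h3.1
          obtain ⟨rfl, hlm⟩ := iht ih.2 ss h3.2 hT.2 hS.2 hlen hTl.2 hSl.2
          exact ⟨rfl, hlm⟩

end LTree

/-- Cutting a word at all occurrences of the letter `i`. -/
theorem exists_blocks (i : ℕ) (w : List ℕ) :
    ∃ (us : List (List ℕ)) (rest : List ℕ), w = us.flatMap (· ++ [i]) ++ rest ∧
      us.length = w.count i ∧ i ∉ rest ∧ ∀ u ∈ us, i ∉ u := by
  induction w with
  | nil => exact ⟨[], [], by simp⟩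
  | cons x w ih =>
    obtain ⟨us, rest, hw, hl, hr, hu⟩ := ih
    by_cases hx : x = i
    · subst hx
      exact ⟨[] :: us, rest, by simp [← hw], by simp [hl], hr, by simpa using hu⟩
    · rcases us with _ | ⟨u, us⟩
      · exact ⟨[], x :: rest, by simp [hw], by simp_all, by simp [hr, Ne.symm hx], by simp⟩
      · refine ⟨(x :: u) :: us, rest, by simp [hw], ?_, hr, ?_⟩
        · rw [List.count_cons_of_ne hx, ← hl]; simp
        · rw [List.forall_mem_cons] at hu ⊢
          exact ⟨by simp [Ne.symm hx, hu.1], hu.2⟩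

theorem count_eq_of_infix {k : ℕ → ℕ} {A u B : List ℕ}
    (hc : ∀ x ∈ A ++ u ++ B, (A ++ u ++ B).count x = k x)
    (hd : ∀ x ∈ u, x ∉ A ∧ x ∉ B) : ∀ x ∈ u, u.count x = k x := by
  intro x hx
  rw [← hc x (by simp [hx])]
  simp [List.count_eq_zero_of_not_mem (hd x hx).1, List.count_eq_zero_of_not_mem (hd x hx).2]

open LTree in
theorem exists_forest {k : ℕ → ℕ} (N : ℕ) : ∀ w : List ℕ, w.length ≤ N → NoDip w →
    (∀ x ∈ w, w.count x = k x) → ∃ ts : List LTree,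
      (ts.flatMap fun s => s.toWord false) = w ∧ ∀ t ∈ ts, t.oddOK k false ∧ t.incr := by
  induction N with
  | zero =>
    intro w hw _ _
    exact ⟨[], by simp_all⟩
  | succ N ih =>
    intro w hN hw hc
    rcases w with _ | ⟨i, w⟩
    · exact ⟨[], by simp⟩
    obtain ⟨us, rest, rfl, hl, hr, hu⟩ := exists_blocks i w
    have hlen : us.length = k i - 1 := by
      have := hc i (by simp)
      rw [List.count_cons_self] at this
      omega
    -- each block is enclosed by two occurrences of `i`
    have hblock : ∀ u ∈ us, ∃ A B, i :: (us.flatMap (· ++ [i]) ++ rest) =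
        (A ++ [i]) ++ u ++ ([i] ++ B) := by
      clear hc hw hN ih hl hu hlen
      intro u hu
      induction us with
      | nil => simp at hu
      | cons v us ihu =>
        rcases List.mem_cons.1 hu with rfl | hu
        · exact ⟨[], us.flatMap (· ++ [i]) ++ rest, by simp⟩
        · obtain ⟨A, B, h⟩ := ihu hu
          refine ⟨i :: v ++ A, B, ?_⟩
          simp only [List.flatMap_cons, List.append_assoc, List.cons_append, List.nil_append]
            at h ⊢
          rw [h]
    have hgt : ∀ u ∈ us, ∀ x ∈ u, i < x := by
      intro u hu' x hx
      obtain ⟨A, B, h⟩ := hblock u hu'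
      by_contra hlt
      have hne : x ≠ i := fun h => hu u hu' (h ▸ hx)
      refine hw i x (by omega) ?_
      rw [h]
      have h1 : [i].Sublist (A ++ [i]) := by simp
      have h2 : [x].Sublist u := by simpa using hx
      have h3 : [i].Sublist ([i] ++ B) := by simp
      exact (h1.append h2).append h3
    have hex : ∀ u ∈ us, ∃ ts : List LTree,
        (ts.flatMap fun s => s.toWord false) = u ∧ ∀ t ∈ ts, t.oddOK k false ∧ t.incr := by
      intro u hu'
      obtain ⟨A, B, h⟩ := hblock u hu'
      rw [h] at hN hw hc
      refine ih u (by simp at hN; omega) (hw.sublist ?_) (count_eq_of_infix hc ?_)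
      · exact (List.sublist_append_right _ _).trans (List.sublist_append_left _ _)
      · intro x hx
        have hix := hgt u hu' x hx
        have h2 : [x].Sublist u := by simpa using hx
        constructor
        · intro hA
          have hA : x ∈ A := by
            simp only [List.mem_append, List.mem_singleton] at hA
            exact hA.resolve_right (by omega)
          have h1 : ([x] ++ [i]).Sublist (A ++ [i]) :=
            List.Sublist.append (by simpa using hA) (List.Sublist.refl _)
          exact hw x i hix ((h1.append h2).trans (List.sublist_append_left _ _))
        · intro hB
          have hB : x ∈ B := by
            simp only [List.mem_append, List.mem_singleton] at hB
            exact hB.resolve_left (by omega)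
          have h1 : ([i] ++ [x]).Sublist ([i] ++ B) :=
            List.Sublist.append (List.Sublist.refl _) (by simpa using hB)
          have h3 := (h2.append h1).trans (List.sublist_append_right (A ++ [i]) _)
          exact hw x i hix (by simpa using h3)
    obtain ⟨rs, hrs, hrs'⟩ : ∃ ts : List LTree, (ts.flatMap fun s => s.toWord false) = rest ∧
        ∀ t ∈ ts, t.oddOK k false ∧ t.incr := by
      refine ih rest (by simp at hN; omega) (hw.sublist ?_) ?_
      · exact List.Sublist.cons _ (List.sublist_append_right _ _)
      · refine count_eq_of_infix (A := i :: us.flatMap (· ++ [i])) (B := [])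
          (by simpa using hc) fun x hx => ⟨fun hA => ?_, by simp⟩
        have hxi : x ≠ i := fun h => hr (h ▸ hx)
        obtain ⟨u, hu', hxu⟩ : ∃ u ∈ us, x ∈ u := by
          simp only [List.mem_cons, List.mem_flatMap, List.mem_append, List.not_mem_nil,
            or_false] at hA
          grind
        have h1 : [x, i].Sublist (us.flatMap (· ++ [i])) := by
          refine List.Sublist.trans ?_ (List.sublist_flatten_of_mem (List.mem_map_of_mem hu'))
          exact List.Sublist.append (l₁ := [x]) (by simpa using hxu) (List.Sublist.refl [i])
        have h2 : [x].Sublist rest := by simpa using hx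
        exact hw x i (hgt u hu' x hxu) (List.Sublist.cons i (h1.append h2))
    choose! f hf hf' using hex
    refine ⟨node i (us.map fun u => node i (f u)) :: rs, ?_, ?_⟩
    · have : (us.flatMap fun u => (f u).flatMap (fun s => s.toWord false) ++ [i]) =
          us.flatMap (· ++ [i]) := List.flatMap_congr fun u hu' => by rw [hf u hu']
      simp only [List.flatMap_cons, toWord_false, List.flatMap_map, toWord_true, hrs, this,
        List.cons_append]
    · refine List.forall_mem_cons.2 ⟨?_, hrs'⟩
      simp only [oddOK_node, incr_node, List.length_map, List.forall_mem_map, label]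
      refine ⟨⟨fun _ => ⟨hlen, by simp⟩, fun u hu' => ⟨by simp, fun s hs =>
        (hf' u hu' s hs).1⟩⟩, fun _ _ => le_rfl, fun u hu' => ⟨fun s hs => ?_, fun s hs =>
        (hf' u hu' s hs).2⟩⟩
      refine (hgt u hu' _ ?_).le
      rw [← hf u hu']
      exact List.mem_flatMap.2 ⟨s, hs, s.label_mem_toWord_false⟩

/-- The number of adjacent pairs of `x :: l ++ [y]` satisfying `r`. -/
def adjCount (r : ℕ × ℕ → Bool) (x : ℕ) (l : List ℕ) (y : ℕ) : ℕ :=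
  ((x :: (l ++ [y])).zip (l ++ [y])).countP r

theorem adjCount_nil (r : ℕ × ℕ → Bool) (x y : ℕ) :
    adjCount r x [] y = if r (x, y) then 1 else 0 := by
  simp [adjCount, List.countP_cons]

theorem adjCount_cons (r : ℕ × ℕ → Bool) (x z : ℕ) (l : List ℕ) (y : ℕ) :
    adjCount r x (z :: l) y = (if r (x, z) then 1 else 0) + adjCount r z l y := by
  simp [adjCount, List.countP_cons, add_comm]

theorem adjCount_append_cons (r : ℕ × ℕ → Bool) (x z : ℕ) (l m : List ℕ) (y : ℕ) :
    adjCount r x (l ++ z :: m) y = adjCount r x l z + adjCount r z m y := by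
  induction l generalizing x with
  | nil => rw [List.nil_append, adjCount_cons, adjCount_nil]
  | cons w l ih => rw [List.cons_append, adjCount_cons, adjCount_cons, ih, add_assoc]

theorem countP_zip_rotate (r : ℕ × ℕ → Bool) (a : ℕ) (l : List ℕ) :
    ((a :: l).zip ((a :: l).rotate 1)).countP r = adjCount r a l a := by
  have : (a :: (l ++ [a])).zip (l ++ [a]) = (a :: l).zip (l ++ [a]) := by
    have := List.zip_append (l₁ := a :: l) (l₂ := l ++ [a]) (r₁ := [a]) (r₂ := []) (by simp)
    simpa using this
  rw [adjCount, this]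
  simp

theorem adjCount_eq_zero_of_forall_eq {r : ℕ × ℕ → Bool} {a : ℕ} (hr : r (a, a) = false)
    {l : List ℕ} (hl : ∀ x ∈ l, x = a) : adjCount r a l a = 0 := by
  induction l with
  | nil => simp [adjCount_nil, hr]
  | cons z l ih =>
    obtain rfl := hl z (by simp)
    rw [adjCount_cons, ih (fun x hx => hl x (by simp [hx]))]
    simp [hr]

theorem adjCount_eq_of_nodup {r : ℕ × ℕ → Bool} (hr : ∀ x y, r (x, y) = true ↔ x = y) {a : ℕ}
    {l : List ℕ} (hl : (a :: l).Nodup) : adjCount r a l a = if l.isEmpty then 1 else 0 := by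
  have key : ∀ (l : List ℕ) (x y : ℕ), l ≠ [] → (x :: l).Nodup → y ∉ l →
      adjCount r x l y = 0 := by
    intro l
    induction l with
    | nil => simp
    | cons z l ih =>
      intro x y _ hl hy
      simp only [List.nodup_cons, List.mem_cons, not_or] at hl hy
      rw [adjCount_cons]
      rcases l with _ | ⟨z', l⟩
      · simp [adjCount_nil, hr, hl.1.1, Ne.symm hy.1]
      · rw [ih z y (by simp) (by simpa using hl.2) (by simpa using hy.2)]
        simp [hr, hl.1.1]
  rcases l with _ | ⟨z, l⟩
  · simp [adjCount_nil, hr]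
  · rw [key _ _ _ (by simp) hl (List.nodup_cons.1 hl).1]
    simp

namespace LTree

theorem adjCount_toWord {k : ℕ → ℕ} {r : ℕ × ℕ → Bool} {st : LTree → Bool → ℕ}
    (heven : ∀ a ts, (node a ts).Good k true →
      st (node a ts) true = adjCount r a (ts.map label) a + (ts.map fun s => st s false).sum)
    (hodd : ∀ a ts, (∀ s ∈ ts, s.label = a) →
      st (node a ts) false = (ts.map fun s => st s true).sum) (T : LTree) :
    (T.Good k true → adjCount r T.label (T.toWord true) T.label = st T true) ∧
    (T.Good k false → ∀ x l y, adjCount r x (T.toWord false ++ l) y =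
      (if r (x, T.label) then 1 else 0) + st T false + adjCount r T.label l y) := by
  induction T using induction_on_children with
  | h a ts ih =>
    constructor
    · intro h
      rw [heven a ts h, toWord_true]
      replace h := fun s hs => h.child (s := s) hs
      suffices ∀ x y, adjCount r x (ts.flatMap fun s => s.toWord false) y =
        adjCount r x (ts.map label) y + (ts.map fun s => st s false).sum from this a a
      clear heven hodd
      induction ts with
      | nil => simp
      | cons t ts iht =>
        simp only [List.forall_mem_cons] at ih h
        intro x y
        rw [List.flatMap_cons, ih.1.2 h.1, iht ih.2 h.2, List.map_cons, adjCount_cons,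
          List.map_cons, List.sum_cons]
        omega
    · intro h x l y
      have hl := ((oddOK_node.1 h.oddOK).1 rfl).2
      rw [hodd a ts hl, toWord_false, List.cons_append, adjCount_cons, add_assoc]
      replace h := fun s hs => h.child (s := s) hs
      congr 1
      clear heven hodd
      simp only [label]
      induction ts with
      | nil => simp
      | cons t ts iht =>
        simp only [List.forall_mem_cons] at ih h hl
        have h1 := ih.1.1 h.1
        rw [hl.1] at h1
        rw [List.flatMap_cons, List.append_assoc, List.append_assoc, List.singleton_append,
          adjCount_append_cons, h1, iht ih.2 hl.2 h.2, List.map_cons, List.sum_cons, add_assoc]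

theorem cdes_eq_desW {k : ℕ → ℕ} {T : LTree} (h : T.Good k true) (h0 : T.label = 0) :
    T.cdes = desW (T.toWord true) := by
  have := (adjCount_toWord (k := k) (r := fun p => decide (p.2 < p.1)) (st := fun T _ => T.cdes)
    (fun a ts _ => ?_) (fun a ts hts => ?_) T).1 h
  · rw [h0] at this
    exact this.symm
  · rw [cdes_node, cdesW, countP_zip_rotate]
  · rw [cdes_node, cdesW, countP_zip_rotate, adjCount_eq_zero_of_forall_eq (by simp)
      (by simpa using hts), zero_add]

theorem casc_eq_ascW {k : ℕ → ℕ} {T : LTree} (h : T.Good k true) (h0 : T.label = 0) :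
    T.casc = ascW (T.toWord true) := by
  have := (adjCount_toWord (k := k) (r := fun p => decide (p.1 < p.2)) (st := fun T _ => T.casc)
    (fun a ts _ => ?_) (fun a ts hts => ?_) T).1 h
  · rw [h0] at this
    exact this.symm
  · rw [casc_node, cascW, countP_zip_rotate]
  · rw [casc_node, cascW, countP_zip_rotate, adjCount_eq_zero_of_forall_eq (by simp)
      (by simpa using hts), zero_add]

theorem eleaf_eq_platW {k : ℕ → ℕ} {T : LTree} (h : T.Good k true) (h0 : T.label = 0) :
    T.eleaf = platW (T.toWord true) := by
  have := (adjCount_toWord (k := k) (r := fun p => decide (p.1 = p.2)) (st := eleafAux)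
    (fun a ts hT => ?_) (fun a ts _ => ?_) T).1 h
  · rw [h0] at this
    exact this.symm
  · rw [eleafAux_node, adjCount_eq_of_nodup (by simp) hT.nodup]
    simp
  · simp [eleafAux_node]

end LTree

theorem count_msetM (n : ℕ) (k : ℕ → ℕ) (x : ℕ) :
    (msetM n k).count x = if x ∈ Finset.Icc 1 n then k x else 0 := by
  rw [msetM, Multiset.count_sum', Finset.sum_congr rfl fun i _ => Multiset.count_replicate x i (k i)]
  simp

theorem count_eq_of_coe_eq_msetM {n : ℕ} {k : ℕ → ℕ} {w : List ℕ}
    (hw : (w : Multiset ℕ) = msetM n k) :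
    (∀ x, w.count x ≤ k x) ∧ (∀ x ∈ w, w.count x = k x) ∧ 0 ∉ w := by
  have h : ∀ x, w.count x = if x ∈ Finset.Icc 1 n then k x else 0 := fun x => by
    rw [← count_msetM, ← hw, Multiset.coe_count]
  refine ⟨fun x => ?_, fun x hx => ?_, fun h0 => ?_⟩
  · rw [h]; split_ifs <;> simp
  · have := List.count_pos_iff.2 hx
    rw [h] at this ⊢
    split_ifs at this ⊢ with hx'
    · rfl
    · simp at this
  · have := List.count_pos_iff.2 h0
    simp [h] at this

theorem memIT.coe_toWord {n : ℕ} {k : ℕ → ℕ} {T : LTree} (h : memIT n k T) :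
    (T.toWord true : Multiset ℕ) = msetM n k := by
  obtain ⟨⟨h0, hl, ho⟩, _⟩ := h
  rwa [(LTree.labels_eq_toWord T).1 ho, h0, Multiset.cons_inj_right] at hl

theorem memIT.good {n : ℕ} {k : ℕ → ℕ} {T : LTree} (h : memIT n k T) : T.Good k true := by
  obtain ⟨h1, -, h2⟩ := count_eq_of_coe_eq_msetM h.coe_toWord
  exact ⟨h.1.2.2, h1, fun _ => by rwa [h.1.1]⟩

/-- For a nonempty multiset `M = {1^{k 1}, …, n^{k n}}` with every `k i ≥ 1`, there is a
bijection `φ` from `ℐ𝒯_M` (weakly increasing trees in `𝒯_M`) onto the set of Stirling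
permutations of `M` with `cdes T = des (φ T)`, `casc T = asc (φ T)` and
`eleaf T = plat (φ T)` for all `T ∈ ℐ𝒯_M`. -/
theorem exists_bijection_increasing_trees_to_Stirling
    (n : ℕ) (hn : 1 ≤ n) (k : ℕ → ℕ) (hk : ∀ i, 1 ≤ i → i ≤ n → 1 ≤ k i) :
    ∃ φ : LTree → List ℕ,
      Set.BijOn φ {T : LTree | memIT n k T}
        {w : List ℕ | (↑w : Multiset ℕ) = msetM n k ∧ IsStirling w} ∧
      ∀ T : LTree, memIT n k T →
        T.cdes = desW (φ T) ∧ T.casc = ascW (φ T) ∧ T.eleaf = platW (φ T) := by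
  refine ⟨fun T => T.toWord true, ⟨fun T hT => ⟨hT.coe_toWord, ?_⟩, fun T hT S hS hTS => ?_,
    fun w hw => ?_⟩, fun T hT => ⟨LTree.cdes_eq_desW hT.good hT.1.1,
      LTree.casc_eq_ascW hT.good hT.1.1, LTree.eleaf_eq_platW hT.good hT.1.1⟩⟩
  · rw [isStirling_iff_noDip]
    exact (LTree.noDip_toWord T true hT.good hT.2).1
  · exact (LTree.toWord_injective T).1 S hT.good hS.good (hT.1.1.trans hS.1.1.symm) hTS
  · obtain ⟨ts, hts, h⟩ := exists_forest (k := k) w.length w le_rfl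
      ((isStirling_iff_noDip w).1 hw.2) (count_eq_of_coe_eq_msetM hw.1).2.1
    have ho : (LTree.node 0 ts).oddOK k true :=
      LTree.oddOK_node.2 ⟨by simp, fun s hs => (h s hs).1⟩
    have hword : (LTree.node 0 ts).toWord true = w := by rw [LTree.toWord_true, hts]
    refine ⟨LTree.node 0 ts, ⟨⟨rfl, ?_, ho⟩, LTree.incr_node.2 ⟨by simp, fun s hs =>
      (h s hs).2⟩⟩, hword⟩
    rw [(LTree.labels_eq_toWord _).1 ho, hword, hw.1]
    rfl
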